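/- Let f : ℝ^d → ℝ be measurable with 0 ≤ f(x) ≤ N₁ for all x and ∫_{ℝ^d} |x|² f(x) dx ≤ N₂ for positive constants N₁, N₂. Then ∫_{ℝ^d} f(x) dx ≤ C_d · N₁^{2/(d+2)} · N₂^{d/(d+2)}, where C_d = ((d+2)/d)^{d/(d+2)} Vol(S^{d-1})^{2/(d+2)}. -/

import Mathlib

open MeasureTheory Real

theorem integral_ball_sq_sub_norm_sq {E : Type*} [NormedAddCommGroup E] [NormedSpace ℝ E]
    [FiniteDimensional ℝ E] [Nontrivial E] [MeasurableSpace E] [BorelSpace E]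
    (μ : Measure E) [μ.IsAddHaarMeasure] {R : ℝ} (hR : 0 ≤ R) :
    ∫ x in Metric.closedBall (0 : E) R, (R ^ 2 - ‖x‖ ^ 2) ∂μ =
      2 / (Module.finrank ℝ E + 2) * μ.real (Metric.ball 0 1) * R ^ (Module.finrank ℝ E + 2) := by
  have hind : (Metric.closedBall (0 : E) R).indicator (fun x => R ^ 2 - ‖x‖ ^ 2) =
      fun x => (Set.Iic R).indicator (fun r => R ^ 2 - r ^ 2) ‖x‖ := by
    ext x
    simp [Set.indicator]
  rw [← integral_indicator Metric.isClosed_closedBall.measurableSet, hind,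
    integral_fun_norm_addHaar]
  obtain ⟨n, hn⟩ : ∃ n, Module.finrank ℝ E = n + 1 :=
    Nat.exists_eq_succ_of_ne_zero (Module.finrank_pos (R := ℝ) (M := E)).ne'
  have hint : ∫ y in Set.Ioi (0 : ℝ), y ^ n • (Set.Iic R).indicator (fun r => R ^ 2 - r ^ 2) y =
      ∫ y in (0 : ℝ)..R, (R ^ 2 * y ^ n - y ^ (n + 2)) := by
    rw [intervalIntegral.integral_of_le hR, ← Set.Ioi_inter_Iic, ← setIntegral_indicator
      measurableSet_Iic]
    refine integral_congr_ae (Filter.Eventually.of_forall fun y => ?_)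
    by_cases hy : y ≤ R <;> simp [Set.indicator, hy]
    ring
  rw [hn, Nat.add_sub_cancel, hint, intervalIntegral.integral_sub
    ((by fun_prop : Continuous fun y : ℝ => R ^ 2 * y ^ n).intervalIntegrable _ _)
    ((by fun_prop : Continuous fun y : ℝ => y ^ (n + 2)).intervalIntegrable _ _),
    intervalIntegral.integral_const_mul, integral_pow, integral_pow]
  simp only [nsmul_eq_mul, smul_eq_mul]
  push_cast
  have h1 : (n : ℝ) + 1 ≠ 0 := by positivity
  have h3 : (n : ℝ) + 1 + 2 ≠ 0 := by positivity
  have h3' : (n : ℝ) + 2 + 1 ≠ 0 := by positivity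
  field_simp
  ring

/-- The bathtub inequality for the second moment. -/
theorem sq_mul_integral_le {E : Type*} [NormedAddCommGroup E] [NormedSpace ℝ E]
    [FiniteDimensional ℝ E] [Nontrivial E] [MeasurableSpace E] [BorelSpace E]
    (μ : Measure E) [μ.IsAddHaarMeasure] {f : E → ℝ} {N : ℝ} (hf0 : ∀ x, 0 ≤ f x)
    (hfN : ∀ x, f x ≤ N) (hint : Integrable (fun x => ‖x‖ ^ 2 * f x) μ) {R : ℝ} (hR : 0 ≤ R) :
    R ^ 2 * ∫ x, f x ∂μ ≤ (∫ x, ‖x‖ ^ 2 * f x ∂μ) +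
      N * (2 / (Module.finrank ℝ E + 2) * μ.real (Metric.ball 0 1) *
        R ^ (Module.finrank ℝ E + 2)) := by
  have hball : Integrable ((Metric.closedBall (0 : E) R).indicator
      fun x => R ^ 2 - ‖x‖ ^ 2) μ :=
    IntegrableOn.integrable_indicator
      (ContinuousOn.integrableOn_compact (isCompact_closedBall 0 R) (by fun_prop))
      Metric.isClosed_closedBall.measurableSet
  rw [← integral_ball_sq_sub_norm_sq μ hR,
    ← integral_indicator Metric.isClosed_closedBall.measurableSet, ← integral_const_mul,
    ← integral_const_mul, ← integral_add hint (hball.const_mul N)]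
  refine integral_mono_of_nonneg (Filter.Eventually.of_forall fun x =>
    mul_nonneg (sq_nonneg R) (hf0 x)) (hint.add (hball.const_mul N))
    (Filter.Eventually.of_forall fun x => ?_)
  by_cases hx : ‖x‖ ≤ R
  · have : 0 ≤ R ^ 2 - ‖x‖ ^ 2 := by nlinarith [norm_nonneg x]
    simp only [Set.indicator, mem_closedBall_zero_iff, hx, if_true]
    nlinarith [hfN x]
  · have : 0 ≤ ‖x‖ ^ 2 - R ^ 2 := by nlinarith [norm_nonneg x]
    simp only [Set.indicator, mem_closedBall_zero_iff, hx, if_false]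
    nlinarith [hf0 x]

/-- Optimizing a one-parameter family of bounds over the radius `R`; the best choice is
`R ^ (d + 2) = (d + 2) * N₂ / (d * ω * N₁)`. -/
theorem le_of_forall_sq_mul_le {d : ℕ} (hd : 1 ≤ d) {I ω N₁ N₂ : ℝ} (hω : 0 < ω) (hN₁ : 0 < N₁)
    (hN₂ : 0 < N₂)
    (h : ∀ R : ℝ, 0 < R → R ^ 2 * I ≤ N₂ + N₁ * (2 / (d + 2) * ω * R ^ (d + 2))) :
    I ≤ (((d : ℝ) + 2) / d) ^ ((d : ℝ) / (d + 2)) * ω ^ ((2 : ℝ) / (d + 2)) *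
        N₁ ^ ((2 : ℝ) / (d + 2)) * N₂ ^ ((d : ℝ) / (d + 2)) := by
  have hd0 : (0 : ℝ) < d := by exact_mod_cast hd
  have hd2 : (0 : ℝ) < d + 2 := by positivity
  set c : ℝ := ((d : ℝ) + 2) / d with hc
  have hc0 : 0 < c := by positivity
  set A : ℝ := c * N₂ / (ω * N₁) with hA
  have hA0 : 0 < A := by positivity
  set R : ℝ := A ^ ((1 : ℝ) / (d + 2)) with hR
  have hR0 : 0 < R := by positivity
  have hRd : R ^ (d + 2) = A := by
    rw [hR, ← Real.rpow_natCast, ← Real.rpow_mul hA0.le]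
    push_cast
    rw [one_div_mul_cancel hd2.ne', Real.rpow_one]
  have hR2 : R ^ 2 = A ^ ((2 : ℝ) / (d + 2)) := by
    rw [hR, ← Real.rpow_natCast, ← Real.rpow_mul hA0.le]
    congr 1
    push_cast
    ring
  have hsplit : ∀ x : ℝ, 0 < x → x ^ ((d : ℝ) / (d + 2)) = x / x ^ ((2 : ℝ) / (d + 2)) := by
    intro x hx
    rw [eq_div_iff (by positivity), ← Real.rpow_add hx, ← add_div, div_self hd2.ne',
      Real.rpow_one]
  have key := h R hR0
  have hval : N₂ + N₁ * (2 / (d + 2) * ω * A) = c * N₂ := by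
    rw [hA, hc]
    field_simp
  rw [hRd, hval, hR2] at key
  have hdiv : I ≤ c * N₂ / A ^ ((2 : ℝ) / (d + 2)) := by
    rw [le_div_iff₀ (by positivity)]
    linarith
  refine hdiv.trans_eq ?_
  rw [hsplit c hc0, hsplit N₂ hN₂, hA, Real.div_rpow (by positivity) (by positivity),
    Real.mul_rpow hc0.le hN₂.le, Real.mul_rpow hω.le hN₁.le]
  field_simp

theorem EuclideanSpace.lipschitzWith_tail (n : ℕ) :
    LipschitzWith 1 (fun (x : EuclideanSpace ℝ (Fin (n + 1))) (j : Fin n) => x j.succ) := by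
  refine LipschitzWith.of_dist_le_mul fun x y => ?_
  rw [NNReal.coe_one, one_mul, dist_pi_le_iff dist_nonneg]
  intro j
  rw [dist_eq_norm, dist_eq_norm]
  exact PiLp.norm_apply_le (x - y) j.succ

/-- The unit ball is contained in the cylinder over the unit ball one dimension lower. -/
theorem EuclideanSpace.volume_ball_succ_le (n : ℕ) :
    volume (Metric.ball (0 : EuclideanSpace ℝ (Fin (n + 1))) 1) ≤
      2 * volume {y : Fin n → ℝ | ∑ j, y j ^ 2 < 1} := by
  have hmp := (volume_preserving_piFinSuccAbove (fun _ : Fin (n + 1) => ℝ) 0).comp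
    (PiLp.volume_preserving_ofLp (Fin (n + 1)))
  have hV : MeasurableSet {y : Fin n → ℝ | ∑ j, y j ^ 2 < 1} :=
    measurableSet_lt (by fun_prop) (by fun_prop)
  have h2 : (2 : ENNReal) * volume {y : Fin n → ℝ | ∑ j, y j ^ 2 < 1} =
      volume (Set.Icc (-1 : ℝ) 1 ×ˢ {y : Fin n → ℝ | ∑ j, y j ^ 2 < 1}) := by
    rw [Measure.volume_eq_prod, Measure.prod_prod, Real.volume_Icc]
    norm_num
  rw [h2, ← hmp.measure_preimage (measurableSet_Icc.prod hV).nullMeasurableSet]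
  refine measure_mono fun x hx => ?_
  rw [mem_ball_zero_iff] at hx
  have hsum : x 0 ^ 2 + ∑ j : Fin n, x j.succ ^ 2 < 1 := by
    rw [← Fin.sum_univ_succ (fun i => x i ^ 2), ← EuclideanSpace.real_norm_sq_eq]
    nlinarith [norm_nonneg x]
  have h0 : |x 0| ≤ 1 := (PiLp.norm_apply_le x 0).trans hx.le
  refine ⟨abs_le.1 h0, ?_⟩
  change ∑ j : Fin n, x j.succ ^ 2 < 1
  nlinarith [sq_nonneg (x 0)]

theorem EuclideanSpace.volume_le_hausdorffMeasure_hemisphere (n : ℕ) {σ : ℝ} (hσ : σ ^ 2 = 1) :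
    volume {y : Fin n → ℝ | ∑ j, y j ^ 2 < 1} ≤
      μH[n] {x ∈ Metric.sphere (0 : EuclideanSpace ℝ (Fin (n + 1))) 1 | 0 < σ * x 0} := by
  have hle := (EuclideanSpace.lipschitzWith_tail n).hausdorffMeasure_image_le (Nat.cast_nonneg n)
    {x ∈ Metric.sphere (0 : EuclideanSpace ℝ (Fin (n + 1))) 1 | 0 < σ * x 0}
  rw [ENNReal.coe_one, ENNReal.one_rpow, one_mul] at hle
  refine le_trans ?_ hle
  have hvol := hausdorffMeasure_pi_real (ι := Fin n)
  rw [Fintype.card_fin] at hvol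
  rw [hvol]
  refine measure_mono fun y (hy : ∑ j, y j ^ 2 < 1) => ?_
  have hpos : 0 < 1 - ∑ j, y j ^ 2 := by linarith
  refine ⟨WithLp.toLp 2 (Fin.cons (σ * √(1 - ∑ j, y j ^ 2)) y), ⟨?_, ?_⟩, ?_⟩
  · rw [mem_sphere_zero_iff_norm, ← sq_eq_sq₀ (norm_nonneg _) zero_le_one,
      EuclideanSpace.real_norm_sq_eq, Fin.sum_univ_succ]
    simp [mul_pow, hσ, Real.sq_sqrt hpos.le]
  · have : 0 < √(1 - ∑ j, y j ^ 2) := Real.sqrt_pos.2 hpos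
    simp only [Fin.cons_zero]
    rw [← mul_assoc, ← sq, hσ, one_mul]
    exact this
  · ext j
    simp

/-- Each of the two open hemispheres projects onto the unit ball one dimension lower, so the
Hausdorff measure of the sphere (without normalizing constant) dominates the volume of the ball. -/
theorem EuclideanSpace.volume_ball_le_hausdorffMeasure_sphere (n : ℕ) :
    volume (Metric.ball (0 : EuclideanSpace ℝ (Fin (n + 1))) 1) ≤
      μH[n] (Metric.sphere (0 : EuclideanSpace ℝ (Fin (n + 1))) 1) := by
  refine (EuclideanSpace.volume_ball_succ_le n).trans ?_
  rw [two_mul]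
  refine (add_le_add
    (EuclideanSpace.volume_le_hausdorffMeasure_hemisphere n (σ := 1) (by norm_num))
    (EuclideanSpace.volume_le_hausdorffMeasure_hemisphere n (σ := -1) (by norm_num))).trans ?_
  rw [← measure_union]
  · exact measure_mono (Set.union_subset (fun x hx => hx.1) fun x hx => hx.1)
  · refine Set.disjoint_left.2 fun x hx hx' => ?_
    have h1 := hx.2
    have h2 := hx'.2
    linarith
  · have hcoord : Measurable fun x : EuclideanSpace ℝ (Fin (n + 1)) => (-1 : ℝ) * x 0 := by
      fun_prop
    exact Metric.isClosed_sphere.measurableSet.inter (measurableSet_lt measurable_const hcoord)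

theorem norm_inv_norm_smul_sub_le {E : Type*} [NormedAddCommGroup E] [NormedSpace ℝ E] {x y : E}
    (hx : 1 ≤ ‖x‖) (hy : 1 ≤ ‖y‖) : ‖‖x‖⁻¹ • x - ‖y‖⁻¹ • y‖ ≤ 2 * ‖x - y‖ := by
  have hx0 : 0 < ‖x‖ := by linarith
  have hy0 : 0 < ‖y‖ := by linarith
  have heq : ‖x‖⁻¹ • x - ‖y‖⁻¹ • y = ‖x‖⁻¹ • (x - y) + (‖x‖⁻¹ * (‖y‖ - ‖x‖)) • ‖y‖⁻¹ • y := by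
    rw [smul_smul, smul_sub, sub_add, ← sub_smul]
    congr 2
    field_simp
    ring
  have hinv : ‖x‖⁻¹ ≤ 1 := inv_le_one_of_one_le₀ hx
  have hrev : |‖y‖ - ‖x‖| ≤ ‖x - y‖ := by
    rw [norm_sub_rev]
    exact abs_norm_sub_norm_le y x
  calc ‖‖x‖⁻¹ • x - ‖y‖⁻¹ • y‖
      ≤ ‖x‖⁻¹ * ‖x - y‖ + ‖x‖⁻¹ * |‖y‖ - ‖x‖| := by
        rw [heq]
        refine (norm_add_le _ _).trans_eq ?_
        rw [norm_smul, norm_smul, norm_smul, norm_mul, norm_inv, norm_inv, norm_norm, norm_norm,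
          inv_mul_cancel₀ hy0.ne', mul_one, Real.norm_eq_abs]
    _ ≤ 1 * ‖x - y‖ + 1 * ‖x - y‖ := by gcongr
    _ = 2 * ‖x - y‖ := by ring

/-- Central projection to the unit sphere of the hyperplane `{x | x i = σ}`, which for `σ = ±1`
contains a face of the cube `[-1, 1]^(n + 1)`. -/
noncomputable def cubeFaceToSphere (n : ℕ) (i : Fin (n + 1)) (σ : ℝ) (y : Fin n → ℝ) :
    EuclideanSpace ℝ (Fin (n + 1)) :=
  ‖WithLp.toLp 2 (i.insertNth σ y : Fin (n + 1) → ℝ)‖⁻¹ •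
    WithLp.toLp 2 (i.insertNth σ y : Fin (n + 1) → ℝ)

theorem exists_lipschitzWith_cubeFaceToSphere (n : ℕ) (i : Fin (n + 1)) {σ : ℝ} (hσ : |σ| = 1) :
    ∃ K, LipschitzWith K (cubeFaceToSphere n i σ) := by
  obtain ⟨K, hK⟩ : ∃ K, LipschitzWith K (WithLp.toLp 2 : (Fin (n + 1) → ℝ) → _) :=
    ⟨_, PiLp.lipschitzWith_toLp 2 (fun _ : Fin (n + 1) => ℝ)⟩
  have hone : ∀ y : Fin n → ℝ, 1 ≤ ‖WithLp.toLp 2 (i.insertNth σ y : Fin (n + 1) → ℝ)‖ := by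
    intro y
    have := PiLp.norm_apply_le (WithLp.toLp 2 (i.insertNth σ y : Fin (n + 1) → ℝ)) i
    simpa [hσ] using this
  refine ⟨2 * K, LipschitzWith.of_dist_le_mul fun y z => ?_⟩
  rw [dist_eq_norm]
  refine (norm_inv_norm_smul_sub_le (hone y) (hone z)).trans ?_
  rw [← dist_eq_norm, NNReal.coe_mul, mul_assoc]
  refine mul_le_mul_of_nonneg_left ((hK.dist_le_mul _ _).trans ?_) (by norm_num)
  refine mul_le_mul_of_nonneg_left ?_ K.coe_nonneg
  rw [dist_pi_le_iff dist_nonneg]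
  intro k
  induction k using i.succAboveCases with
  | x => simp
  | p j => simpa using dist_le_pi_dist y z j

theorem sphere_subset_iUnion_cubeFaceToSphere (n : ℕ) :
    Metric.sphere (0 : EuclideanSpace ℝ (Fin (n + 1))) 1 ⊆
      ⋃ i, (cubeFaceToSphere n i 1 '' Set.Icc (-1) 1 ∪
        cubeFaceToSphere n i (-1) '' Set.Icc (-1) 1) := by
  intro x hx
  rw [mem_sphere_zero_iff_norm] at hx
  obtain ⟨i, hi⟩ := Finite.exists_max (fun i => |x i|)
  have hxi : x i ≠ 0 := by
    intro h0
    have hx0 : x = 0 := by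
      ext k
      simpa [h0] using hi k
    simp [hx0] at hx
  have habs : 0 < |x i| := abs_pos.2 hxi
  set y : Fin n → ℝ := fun j => x (i.succAbove j) / |x i| with hy
  have hyI : y ∈ Set.Icc (-1 : Fin n → ℝ) 1 := by
    have hle : ∀ j, |y j| ≤ 1 := fun j => by
      rw [hy, abs_div, abs_abs]
      exact (div_le_one habs).2 (hi _)
    exact ⟨fun j => (abs_le.1 (hle j)).1, fun j => (abs_le.1 (hle j)).2⟩
  have hface : cubeFaceToSphere n i (x i / |x i|) y = x := by
    have hv : WithLp.toLp 2 (i.insertNth (x i / |x i|) y : Fin (n + 1) → ℝ) = |x i|⁻¹ • x := by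
      ext k
      induction k using i.succAboveCases with
      | x => simp [div_eq_inv_mul]
      | p j => simp [hy, div_eq_inv_mul]
    rw [cubeFaceToSphere, hv, norm_smul, hx, smul_smul]
    simp [habs.ne']
  refine Set.mem_iUnion.2 ⟨i, ?_⟩
  rcases lt_or_gt_of_ne hxi with h | h
  · refine Or.inr ⟨y, hyI, ?_⟩
    rwa [abs_of_neg h, div_neg, div_self hxi] at hface
  · refine Or.inl ⟨y, hyI, ?_⟩
    rwa [abs_of_pos h, div_self hxi] at hface

theorem EuclideanSpace.hausdorffMeasure_sphere_lt_top (n : ℕ) :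
    μH[n] (Metric.sphere (0 : EuclideanSpace ℝ (Fin (n + 1))) 1) < ⊤ := by
  have hface : ∀ (i : Fin (n + 1)) (σ : ℝ), |σ| = 1 →
      μH[n] (cubeFaceToSphere n i σ '' Set.Icc (-1) 1) < ⊤ := by
    intro i σ hσ
    obtain ⟨K, hK⟩ := exists_lipschitzWith_cubeFaceToSphere n i hσ
    refine (hK.hausdorffMeasure_image_le (Nat.cast_nonneg n) _).trans_lt ?_
    have hvol := hausdorffMeasure_pi_real (ι := Fin n)
    rw [Fintype.card_fin] at hvol
    rw [hvol]
    exact ENNReal.mul_lt_top (ENNReal.rpow_lt_top_of_nonneg (Nat.cast_nonneg n) ENNReal.coe_ne_top)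
      isCompact_Icc.measure_lt_top
  refine (measure_mono (sphere_subset_iUnion_cubeFaceToSphere n)).trans_lt ?_
  refine (measure_iUnion_fintype_le _ _).trans_lt (ENNReal.sum_lt_top.2 fun i _ => ?_)
  exact measure_union_lt_top (hface i 1 (by simp)) (hface i (-1) (by simp))

/-- upper half of the Li–Yau/Hörmander lemma: if `f : ℝ^d → ℝ` is
measurable with `0 ≤ f ≤ N₁` and `∫ |x|² f(x) dx ≤ N₂`, then
`∫ f ≤ C_d N₁^(2/(d+2)) N₂^(d/(d+2))` where
`C_d = ((d+2)/d)^(d/(d+2)) Vol(S^(d-1))^(2/(d+2))`. -/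
theorem stmt_2 (d : ℕ) (hd : 1 ≤ d) (f : EuclideanSpace ℝ (Fin d) → ℝ)
    (hmeas : Measurable f) (N₁ N₂ : ℝ) (hN₁ : 0 < N₁) (hN₂ : 0 < N₂)
    (hf0 : ∀ x, 0 ≤ f x) (hf1 : ∀ x, f x ≤ N₁)
    (hint : Integrable (fun x : EuclideanSpace ℝ (Fin d) => ‖x‖ ^ 2 * f x))
    (h2 : (∫ x : EuclideanSpace ℝ (Fin d), ‖x‖ ^ 2 * f x) ≤ N₂) :
    (∫ x : EuclideanSpace ℝ (Fin d), f x) ≤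
      (((d : ℝ) + 2) / d) ^ ((d : ℝ) / (d + 2)) *
        ((μH[(d : ℝ) - 1] (Metric.sphere (0 : EuclideanSpace ℝ (Fin d)) 1)).toReal)
          ^ ((2 : ℝ) / (d + 2)) *
        N₁ ^ ((2 : ℝ) / (d + 2)) * N₂ ^ ((d : ℝ) / (d + 2)) := by
  obtain ⟨n, rfl⟩ : ∃ n, d = n + 1 := ⟨d - 1, by omega⟩
  have hdim : (((n + 1 : ℕ) : ℝ) - 1) = n := by push_cast; ring
  rw [hdim]
  have hle : volume.real (Metric.ball (0 : EuclideanSpace ℝ (Fin (n + 1))) 1) ≤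
      (μH[n] (Metric.sphere (0 : EuclideanSpace ℝ (Fin (n + 1))) 1)).toReal :=
    ENNReal.toReal_mono (EuclideanSpace.hausdorffMeasure_sphere_lt_top n).ne
      (EuclideanSpace.volume_ball_le_hausdorffMeasure_sphere n)
  have hpos : 0 < volume.real (Metric.ball (0 : EuclideanSpace ℝ (Fin (n + 1))) 1) :=
    ENNReal.toReal_pos (Metric.measure_ball_pos _ _ one_pos).ne' measure_ball_lt_top.ne
  refine le_of_forall_sq_mul_le hd (hpos.trans_le hle) hN₁ hN₂ fun R hR => ?_
  have hbath := sq_mul_integral_le volume hf0 hf1 hint hR.le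
  rw [finrank_euclideanSpace_fin] at hbath
  refine hbath.trans (add_le_add h2 ?_)
  gcongr
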